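/- Assume that whenever Turing equivalence is written as an increasing union ≡_T = ⋃_n E_n of Borel equivalence relations E_n on 2^ω with E_n ⊆ E_{n+1} for all n, there exist a pointed perfect set P ⊆ 2^ω and some i such that E_i ↾ P = (≡_T) ↾ P. Then for every Borel function f : 2^ω → 2^ω such that x ≡_T y implies f(x) E_0 f(y), the E_0-class of f(x) is constant on a Turing cone: there exist b ∈ 2^ω and w ∈ 2^ω such that f(x) E_0 w for every x with x ≥_T b. -/

import Mathlib

open scoped Classical

namespace SlamanSteel

/-- Partial recursive functions relative to an oracle `O : ℕ → ℕ`
(Mathlib's `Nat.Partrec` with an extra oracle clause). -/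
inductive RecursiveIn (O : ℕ → ℕ) : (ℕ →. ℕ) → Prop
  | zero : RecursiveIn O (pure 0)
  | succ : RecursiveIn O fun n : ℕ => Part.some (Nat.succ n)
  | left : RecursiveIn O fun n : ℕ => Part.some (Nat.unpair n).1
  | right : RecursiveIn O fun n : ℕ => Part.some (Nat.unpair n).2
  | oracle : RecursiveIn O fun n : ℕ => Part.some (O n)
  | pair {f g : ℕ →. ℕ} : RecursiveIn O f → RecursiveIn O g →
      RecursiveIn O fun n => Nat.pair <$> f n <*> g n
  | comp {f g : ℕ →. ℕ} : RecursiveIn O f → RecursiveIn O g →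
      RecursiveIn O fun n => g n >>= f
  | prec {f g : ℕ →. ℕ} : RecursiveIn O f → RecursiveIn O g →
      RecursiveIn O (Nat.unpaired fun a n =>
        n.rec (f a) fun y IH => do { let i ← IH; g (Nat.pair a (Nat.pair y i)) })
  | rfind {f : ℕ →. ℕ} : RecursiveIn O f →
      RecursiveIn O fun a => Nat.rfind fun n => (fun m => m = 0) <$> f (Nat.pair a n)

/-- The oracle (as a function `ℕ → ℕ`) associated to a real `x ∈ 2^ω`. -/
def oracleOf (x : ℕ → Bool) : ℕ → ℕ := fun n => cond (x n) 1 0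

/-- `z ≤_T x` : `z` is computable relative to the oracle `x`. -/
def TuringLE (z x : ℕ → Bool) : Prop :=
  RecursiveIn (oracleOf x) fun n => Part.some (oracleOf z n)

/-- Turing equivalence on `2^ω`. -/
def TuringEquiv (x y : ℕ → Bool) : Prop := TuringLE x y ∧ TuringLE y x

/-- The `j`th column of `y ∈ 2^ω`. -/
def column (y : ℕ → Bool) (j : ℕ) : ℕ → Bool := fun m => y (Nat.pair j m)

/-- `x ≤_m y` : many-one reducibility on `2^ω`. -/
def MLE (x y : ℕ → Bool) : Prop :=
  ∃ ρ : ℕ → ℕ, Computable ρ ∧ ∀ n, x n = y (ρ n)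

/-- `x ≡_m y` : many-one equivalence on `2^ω`. -/
def MEquiv (x y : ℕ → Bool) : Prop := MLE x y ∧ MLE y x

/-- `x ≤₁ y` : one-one reducibility on `2^ω`. -/
def OneLE (x y : ℕ → Bool) : Prop :=
  ∃ ρ : ℕ → ℕ, Computable ρ ∧ Function.Injective ρ ∧ ∀ n, x n = y (ρ n)

/-- `x ≡₁ y` : one-one equivalence on `2^ω`. -/
def OneEquiv (x y : ℕ → Bool) : Prop := OneLE x y ∧ OneLE y x

/-- The complement `x̄` of a real, flipping every bit. -/
def flipBits (x : ℕ → Bool) : ℕ → Bool := fun n => !(x n)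

/-- The computable join `⊕_i z_i` of a sequence of reals: `(⊕_i z_i)(⟨i,m⟩) = z_i(m)`. -/
def joinSeq (z : ℕ → ℕ → Bool) : ℕ → Bool :=
  fun k => z (Nat.unpair k).1 (Nat.unpair k).2

/-- The computable join of finitely many reals. -/
def joinFin {n : ℕ} (z : Fin n → ℕ → Bool) : ℕ → Bool := fun k =>
  if h : (Nat.unpair k).1 < n then z ⟨(Nat.unpair k).1, h⟩ (Nat.unpair k).2 else false

/-- The initial segment of `x` of length `k`, as a binary string. -/
def initSeg (x : ℕ → Bool) (k : ℕ) : List Bool := (List.range k).map x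

/-- `W` is a set of strings which is computably enumerable relative to the oracle `x`. -/
def CEIn (x : ℕ → Bool) (W : Set (List Bool)) : Prop :=
  ∃ f : ℕ →. ℕ, RecursiveIn (oracleOf x) f ∧
    ∀ σ : List Bool, σ ∈ W ↔ (f (Encodable.encode σ)).Dom

/-- `g` is `x`-generic (1-generic relative to `x`). -/
def GenericIn (x g : ℕ → Bool) : Prop :=
  ∀ W : Set (List Bool), CEIn x W →
    ∃ k, initSeg g k ∈ W ∨ ∀ τ : List Bool, initSeg g k <+: τ → τ ∉ W

/-- `g` is 1-generic. -/
def OneGeneric (g : ℕ → Bool) : Prop := GenericIn (fun _ => false) g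

/-- Reals `z 0, …, z (n-1)` are mutually 1-generic if their join is 1-generic. -/
def MutuallyOneGeneric {n : ℕ} (z : Fin n → ℕ → Bool) : Prop := OneGeneric (joinFin z)

/-- `E` is hyper-`(f_i)`-finite: `E` is an increasing union of Borel subequivalence
relations none of which has a class containing an infinite set `{f i x j : j ∈ ω}`. -/
def HyperFinWrt {X : Type*} [MeasurableSpace X] (E : X → X → Prop)
    (f : ℕ → X → ℕ → X) : Prop :=
  ∃ F : ℕ → X → X → Prop,
    (∀ n, Equivalence (F n)) ∧
    (∀ n, MeasurableSet {p : X × X | F n p.1 p.2}) ∧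
    (∀ n a b, F n a b → F (n + 1) a b) ∧
    (∀ a b, E a b ↔ ∃ n, F n a b) ∧
    (∀ n x i, (Set.range (f i x)).Infinite → ¬ Set.range (f i x) ⊆ {y | F n x y})

/-- `E` is hyper-Borel-finite: hyper-`(f_i)`-finite for every countable sequence of
Borel functions `f_i : X → X^ω`. -/
def HyperBorelFinite {X : Type*} [MeasurableSpace X] (E : X → X → Prop) : Prop :=
  ∀ f : ℕ → X → ℕ → X, (∀ i, Measurable (f i)) → HyperFinWrt E f

/-- Turing equivalence is hyper-recursively-finite: it is an increasing union of Borel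
equivalence relations `F n` such that no `F n`-class of `x` contains, as an infinite
subset, the set of columns of some `y ≤_T x`. -/
def HyperRecFin : Prop :=
  ∃ F : ℕ → (ℕ → Bool) → (ℕ → Bool) → Prop,
    (∀ n, Equivalence (F n)) ∧
    (∀ n, MeasurableSet {p : (ℕ → Bool) × (ℕ → Bool) | F n p.1 p.2}) ∧
    (∀ n a b, F n a b → F (n + 1) a b) ∧
    (∀ a b, TuringEquiv a b ↔ ∃ n, F n a b) ∧
    (∀ n x y, TuringLE y x → (Set.range (column y)).Infinite →
      ¬ Set.range (column y) ⊆ {z | F n x z})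

/-- `T ⊆ 2^{<ω}` is a tree: closed under initial segments. -/
def IsTree (T : Set (List Bool)) : Prop :=
  ∀ σ ∈ T, ∀ τ : List Bool, τ <+: σ → τ ∈ T

/-- `T` is a perfect tree: a nonempty tree in which every node has two incomparable
extensions in `T`. -/
def PerfectTree (T : Set (List Bool)) : Prop :=
  IsTree T ∧ T.Nonempty ∧
    ∀ σ ∈ T, ∃ τ₁ ∈ T, ∃ τ₂ ∈ T,
      σ <+: τ₁ ∧ σ <+: τ₂ ∧ ¬ τ₁ <+: τ₂ ∧ ¬ τ₂ <+: τ₁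

/-- The set `[T]` of infinite branches of a tree `T ⊆ 2^{<ω}`. -/
def branches (T : Set (List Bool)) : Set (ℕ → Bool) :=
  {x | ∀ k, initSeg x k ∈ T}

/-- The real coding a set of strings, via a computable coding of finite binary
strings by natural numbers. -/
noncomputable def codeOfStringSet (T : Set (List Bool)) : ℕ → Bool :=
  fun n => decide (∃ σ ∈ T, Encodable.encode σ = n)

/-- A pointed perfect set: the set of branches `[T]` of a perfect tree
`T ⊆ 2^{<ω}` such that `T ≤_T x` for every `x ∈ [T]`. -/
def PointedPerfect (P : Set (ℕ → Bool)) : Prop :=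
  ∃ T : Set (List Bool), PerfectTree T ∧ P = branches T ∧
    ∀ x ∈ P, TuringLE (codeOfStringSet T) x

/-- `E_0`: eventual equality on `2^ω`. -/
def E0 (x y : ℕ → Bool) : Prop := ∃ N, ∀ n ≥ N, x n = y n

/-! ### Computability relative to a real -/

theorem RecursiveIn.trans {O O' : ℕ → ℕ} (hO : RecursiveIn O' fun n => Part.some (O n))
    {f : ℕ →. ℕ} (hf : RecursiveIn O f) : RecursiveIn O' f := by
  induction hf with
  | zero => exact .zero
  | succ => exact .succ
  | left => exact .left
  | right => exact .right
  | oracle => exact hO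
  | pair _ _ h₁ h₂ => exact .pair h₁ h₂
  | comp _ _ h₁ h₂ => exact .comp h₁ h₂
  | prec _ _ h₁ h₂ => exact .prec h₁ h₂
  | rfind _ h => exact .rfind h

theorem RecursiveIn.of_primrec {O f : ℕ → ℕ} (hf : Nat.Primrec f) :
    RecursiveIn O fun n => Part.some (f n) := by
  induction hf with
  | zero => exact .zero
  | succ => exact .succ
  | left => exact .left
  | right => exact .right
  | pair _ _ h₁ h₂ => simpa [Seq.seq] using RecursiveIn.pair h₁ h₂
  | comp _ _ h₁ h₂ => simpa using RecursiveIn.comp h₁ h₂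
  | @prec f g _ _ h₁ h₂ =>
    refine (congrArg (RecursiveIn O) (funext fun n => ?_)).mpr (RecursiveIn.prec h₁ h₂)
    simp only [Nat.unpaired]
    induction (Nat.unpair n).2 with
    | zero => rfl
    | succ k ih => simp only [← ih]; simp

/-- The function `f` between coded types is computable with the real `x` as an oracle. -/
def OracleComputable (x : ℕ → Bool) {α β : Type} [Primcodable α] [Primcodable β]
    (f : α → β) : Prop :=
  ∃ g : ℕ →. ℕ, RecursiveIn (oracleOf x) g ∧
    ∀ a, g (Encodable.encode a) = Part.some (Encodable.encode (f a))

theorem encode_apply_eq_oracleOf (x : ℕ → Bool) (n : ℕ) :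
    Encodable.encode (x n) = oracleOf x n := by
  unfold oracleOf; cases x n <;> rfl

theorem turingLE_iff_oracleComputable {z x : ℕ → Bool} :
    TuringLE z x ↔ OracleComputable x z := by
  constructor
  · intro h
    exact ⟨_, h, fun n => by rw [encode_apply_eq_oracleOf]; rfl⟩
  · rintro ⟨g, hg, h⟩
    have : g = fun n => Part.some (oracleOf z n) := by
      funext n
      rw [← encode_apply_eq_oracleOf]
      exact h n
    rwa [this] at hg

namespace OracleComputable

variable {x : ℕ → Bool} {α β γ : Type} [Primcodable α] [Primcodable β] [Primcodable γ]

theorem of_turingLE {y : ℕ → Bool} {f : α → β} (hf : OracleComputable x f)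
    (h : TuringLE x y) : OracleComputable y f := by
  obtain ⟨g, hg, hgf⟩ := hf
  exact ⟨g, RecursiveIn.trans h hg, hgf⟩

theorem of_primrec {f : α → β} (hf : Primrec f) : OracleComputable x f := by
  refine ⟨_, RecursiveIn.of_primrec (Nat.Primrec.comp Nat.Primrec.pred hf), fun a => ?_⟩
  simp

theorem comp {f : β → γ} {g : α → β} (hf : OracleComputable x f) (hg : OracleComputable x g) :
    OracleComputable x fun a => f (g a) := by
  obtain ⟨f', hf', hf⟩ := hf
  obtain ⟨g', hg', hg⟩ := hg
  exact ⟨_, .comp hf' hg', fun a => by rw [hg]; exact (Part.bind_some _ _).trans (hf _)⟩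

theorem pair {f : α → β} {g : α → γ} (hf : OracleComputable x f) (hg : OracleComputable x g) :
    OracleComputable x fun a => (f a, g a) := by
  obtain ⟨f', hf', hf⟩ := hf
  obtain ⟨g', hg', hg⟩ := hg
  exact ⟨_, .pair hf' hg', fun a => by simp [hg, hf, Seq.seq]⟩

theorem self : OracleComputable x x :=
  turingLE_iff_oracleComputable.1 .oracle

theorem iterate {h : ℕ × β → β} (hh : OracleComputable x h) {s : ℕ → β}
    (hs : ∀ n, s (n + 1) = h (n, s n)) : OracleComputable x s := by
  obtain ⟨h', hh', hh⟩ := hh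
  have h₀ : RecursiveIn (oracleOf x) fun _ => Part.some (Encodable.encode (s 0)) :=
    RecursiveIn.of_primrec (Nat.Primrec.const _)
  have h₁ : RecursiveIn (oracleOf x) fun n => Part.some (Nat.pair 0 n) :=
    RecursiveIn.of_primrec (Nat.Primrec.pair (Nat.Primrec.const _) Nat.Primrec.id)
  have h₂ := RecursiveIn.prec h₀ (RecursiveIn.comp hh' .right)
  refine ⟨_, RecursiveIn.comp h₂ h₁, fun n => ?_⟩
  simp only [Nat.unpaired, Part.bind_eq_bind, Part.bind_some, Nat.unpair_pair, Encodable.encode_nat]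
  induction n with
  | zero => rfl
  | succ k ih =>
    simp only [ih, Part.bind_some]
    rw [hs, ← hh]
    exact Part.bind_some _ _

theorem find {p : α × ℕ → Bool} (hp : OracleComputable x p) {f : α → ℕ}
    (h₁ : ∀ a, p (a, f a) = true) (h₂ : ∀ a m, m < f a → p (a, m) = false) :
    OracleComputable x f := by
  obtain ⟨q, hq, hqp⟩ := comp (of_primrec Primrec.not) hp
  refine ⟨_, .rfind hq, fun a => ?_⟩
  refine Part.eq_some_iff.2 (Nat.mem_rfind.2 ?_)
  have key : ∀ m, q (Nat.pair (Encodable.encode a) m) = Part.some (Encodable.encode (!p (a, m))) :=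
    fun m => hqp (a, m)
  simp only [key, Part.map_eq_map, Part.map_some, Part.mem_some_iff, Encodable.encode_nat]
  refine ⟨by simp [h₁], fun {m} hm => by simp [h₂ a m hm]⟩

end OracleComputable

theorem TuringLE.refl (x : ℕ → Bool) : TuringLE x x := .oracle

theorem TuringLE.trans {x y z : ℕ → Bool} (h₁ : TuringLE x y) (h₂ : TuringLE y z) :
    TuringLE x z := RecursiveIn.trans h₂ h₁

theorem TuringEquiv.refl (x : ℕ → Bool) : TuringEquiv x x := ⟨.refl x, .refl x⟩

theorem TuringEquiv.symm {x y : ℕ → Bool} (h : TuringEquiv x y) : TuringEquiv y x := ⟨h.2, h.1⟩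

theorem TuringEquiv.trans {x y z : ℕ → Bool} (h₁ : TuringEquiv x y) (h₂ : TuringEquiv y z) :
    TuringEquiv x z := ⟨h₁.1.trans h₂.1, h₂.2.trans h₁.2⟩

/-- A real is computable from any real it is many-one reducible to, by a primitive recursive
reduction. -/
theorem TuringLE.of_primrec {z x : ℕ → Bool} {ρ : ℕ → ℕ} (hρ : Primrec ρ)
    (h : ∀ n, z n = x (ρ n)) : TuringLE z x := by
  rw [turingLE_iff_oracleComputable, show z = fun n => x (ρ n) from funext h]
  exact .comp .self (.of_primrec hρ)

/-- The join `x ⊕ y`, with `x` on the even numbers and `y` on the odd numbers. -/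
def join (x y : ℕ → Bool) : ℕ → Bool := fun n => cond n.bodd (y n.div2) (x n.div2)

theorem left_turingLE_join (x y : ℕ → Bool) : TuringLE x (join x y) := by
  refine .of_primrec (ρ := fun n => 2 * n) (Primrec.nat_mul.comp (.const 2) .id) fun n => ?_
  simp [join]

theorem right_turingLE_join (x y : ℕ → Bool) : TuringLE y (join x y) := by
  refine .of_primrec (ρ := fun n => 2 * n + 1)
    (Primrec.succ.comp (Primrec.nat_mul.comp (.const 2) .id)) fun n => ?_
  simp [join, Nat.div2_val]

theorem turingLE_joinSeq (z : ℕ → ℕ → Bool) (i : ℕ) : TuringLE (z i) (joinSeq z) := by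
  refine .of_primrec (ρ := fun n => Nat.pair i n)
    (Primrec₂.natPair.comp (.const i) .id) fun n => ?_
  simp [joinSeq]

/-! ### Coding a real along an extension strategy -/

/-- Starting from the string `σ₀`, alternately extend by the strategy `ρ` and append the next
bit of `d`. -/
def codingStr (ρ : ℕ × List Bool → List Bool) (σ₀ : List Bool) (d : ℕ → Bool) : ℕ → List Bool
  | 0 => σ₀
  | n + 1 => codingStr ρ σ₀ d n ++ ρ (n, codingStr ρ σ₀ d n) ++ [d n]

/-- The real whose initial segments are the strings `codingStr ρ σ₀ d n`. -/
def codingReal (ρ : ℕ × List Bool → List Bool) (σ₀ : List Bool) (d : ℕ → Bool) : ℕ → Bool :=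
  fun n => (codingStr ρ σ₀ d (n + 1)).getD n false

/-- Recovers the strings `codingStr ρ σ₀ d n` from `codingReal ρ σ₀ d`. -/
def decodingStr (ρ : ℕ × List Bool → List Bool) (σ₀ : List Bool) (x : ℕ → Bool) : ℕ → List Bool
  | 0 => σ₀
  | n + 1 => decodingStr ρ σ₀ x n ++ ρ (n, decodingStr ρ σ₀ x n) ++
      [x (decodingStr ρ σ₀ x n ++ ρ (n, decodingStr ρ σ₀ x n)).length]

/-- Recovers `d` from `codingReal ρ σ₀ d`. -/
def decodingReal (ρ : ℕ × List Bool → List Bool) (σ₀ : List Bool) (x : ℕ → Bool) : ℕ → Bool :=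
  fun n => x (decodingStr ρ σ₀ x n ++ ρ (n, decodingStr ρ σ₀ x n)).length

theorem length_initSeg (x : ℕ → Bool) (k : ℕ) : (initSeg x k).length = k := by
  simp [initSeg]

theorem initSeg_prefix (x : ℕ → Bool) {k l : ℕ} (h : k ≤ l) : initSeg x k <+: initSeg x l :=
  List.prefix_iff_eq_take.2 (by simp [initSeg, ← List.map_take, List.take_range, h])

theorem eq_initSeg_of_prefix {x : ℕ → Bool} {k : ℕ} {σ : List Bool} (h : σ <+: initSeg x k) :
    σ = initSeg x σ.length := by
  have hk : σ.length ≤ k := by simpa [length_initSeg] using h.length_le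
  refine (List.prefix_of_prefix_length_le h (initSeg_prefix x hk) ?_).eq_of_length ?_ <;>
    simp [length_initSeg]

theorem initSeg_eq_of_getD {x : ℕ → Bool} {σ : List Bool}
    (h : ∀ n < σ.length, x n = σ.getD n false) : initSeg x σ.length = σ := by
  refine List.ext_getElem (by simp [initSeg]) fun n h₁ h₂ => ?_
  simp [initSeg, h n h₂, h₂]

section Coding

variable (ρ : ℕ × List Bool → List Bool) (σ₀ : List Bool) (d : ℕ → Bool)

theorem codingStr_prefix {m n : ℕ} (h : m ≤ n) : codingStr ρ σ₀ d m <+: codingStr ρ σ₀ d n := by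
  induction n, h using Nat.le_induction with
  | base => exact List.prefix_rfl
  | succ n _ ih =>
    refine ih.trans ?_
    rw [codingStr, List.append_assoc]
    exact List.prefix_append _ _

theorem le_length_codingStr (n : ℕ) : n ≤ (codingStr ρ σ₀ d n).length := by
  induction n with
  | zero => exact Nat.zero_le _
  | succ n ih => simp [codingStr]; omega

theorem getD_eq_of_prefix {σ τ : List Bool} (h : σ <+: τ) {n : ℕ} (hn : n < σ.length) :
    τ.getD n false = σ.getD n false := by
  obtain ⟨υ, rfl⟩ := h
  simp [List.getElem?_append_left hn]

theorem codingReal_apply {n m : ℕ} (h : n < (codingStr ρ σ₀ d m).length) :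
    codingReal ρ σ₀ d n = (codingStr ρ σ₀ d m).getD n false := by
  rw [codingReal, ← getD_eq_of_prefix (codingStr_prefix ρ σ₀ d (le_max_left m (n + 1))) h,
    ← getD_eq_of_prefix (codingStr_prefix ρ σ₀ d (le_max_right m (n + 1)))
      (le_length_codingStr ρ σ₀ d (n + 1))]

theorem initSeg_codingReal {σ : List Bool} {m : ℕ} (h : σ <+: codingStr ρ σ₀ d m) :
    initSeg (codingReal ρ σ₀ d) σ.length = σ :=
  initSeg_eq_of_getD fun n hn => by
    rw [codingReal_apply ρ σ₀ d (hn.trans_le h.length_le), getD_eq_of_prefix h hn]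

theorem codingReal_length (n : ℕ) : codingReal ρ σ₀ d
    (codingStr ρ σ₀ d n ++ ρ (n, codingStr ρ σ₀ d n)).length = d n := by
  rw [codingReal_apply ρ σ₀ d (m := n + 1) (by simp [codingStr]), codingStr]
  simp

theorem decodingStr_codingReal (n : ℕ) :
    decodingStr ρ σ₀ (codingReal ρ σ₀ d) n = codingStr ρ σ₀ d n := by
  induction n with
  | zero => rfl
  | succ n ih => rw [decodingStr, ih, codingReal_length, codingStr]

theorem decodingReal_codingReal : decodingReal ρ σ₀ (codingReal ρ σ₀ d) = d := by
  funext n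
  rw [decodingReal, decodingStr_codingReal, codingReal_length]

variable {ρ}

theorem codingReal_turingLE {u : ℕ → Bool} (hρ : OracleComputable u ρ) {d : ℕ → Bool}
    (hd : TuringLE d u) : TuringLE (codingReal ρ σ₀ d) u := by
  rw [turingLE_iff_oracleComputable] at hd ⊢
  have hstep : OracleComputable u fun p : ℕ × List Bool => p.2 ++ ρ p ++ [d p.1] := by
    have h := ((OracleComputable.of_primrec (x := u) .snd).pair hρ).pair
      (hd.comp (.of_primrec (α := ℕ × List Bool) .fst))
    exact OracleComputable.comp
      (f := fun q : (List Bool × List Bool) × Bool => q.1.1 ++ q.1.2 ++ [q.2])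
      (.of_primrec (Primrec.list_concat.comp
        (Primrec.list_append.comp (Primrec.fst.comp .fst) (Primrec.snd.comp .fst)) .snd)) h
  have hs : OracleComputable u (codingStr ρ σ₀ d) := .iterate hstep fun n => rfl
  exact OracleComputable.comp (f := fun q : List Bool × ℕ => q.1.getD q.2 false)
    (.of_primrec (Primrec.list_getD false))
    ((hs.comp (.of_primrec .succ)).pair (.of_primrec .id))

theorem decodingReal_turingLE {u : ℕ → Bool} (hρ : OracleComputable u ρ) {x : ℕ → Bool}
    (hx : TuringLE x u) : TuringLE (decodingReal ρ σ₀ x) u := by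
  rw [turingLE_iff_oracleComputable] at hx ⊢
  have happ : OracleComputable u fun p : ℕ × List Bool => p.2 ++ ρ p :=
    OracleComputable.comp (f := fun q : List Bool × List Bool => q.1 ++ q.2)
      (.of_primrec Primrec.list_append) ((OracleComputable.of_primrec .snd).pair hρ)
  have hbit : OracleComputable u fun p : ℕ × List Bool => x (p.2 ++ ρ p).length :=
    hx.comp ((OracleComputable.of_primrec Primrec.list_length).comp happ)
  have hstep : OracleComputable u fun p : ℕ × List Bool =>
      p.2 ++ ρ p ++ [x (p.2 ++ ρ p).length] :=
    OracleComputable.comp (f := fun q : List Bool × Bool => q.1 ++ [q.2])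
      (.of_primrec Primrec.list_concat) (happ.pair hbit)
  have hs : OracleComputable u (decodingStr ρ σ₀ x) := .iterate hstep fun n => rfl
  exact hbit.comp ((OracleComputable.of_primrec .id).pair hs)

end Coding

/-- A relation on strings which can always be satisfied is satisfied by a strategy computable
from it. -/
theorem exists_oracleComputable_strategy {R : ℕ × List Bool × List Bool → Bool}
    (hR : ∀ i σ, ∃ τ, R (i, σ, τ) = true) :
    ∃ ρ : ℕ × List Bool → List Bool, (∀ i σ, R (i, σ, ρ (i, σ)) = true) ∧
      ∀ u, OracleComputable u R → OracleComputable u ρ := by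
  have h (p : ℕ × List Bool) :
      ∃ m, R (p.1, p.2, (Encodable.decode (α := List Bool) m).getD []) = true := by
    obtain ⟨τ, hτ⟩ := hR p.1 p.2
    exact ⟨Encodable.encode τ, by simpa using hτ⟩
  have hdec : Primrec fun m : ℕ => (Encodable.decode (α := List Bool) m).getD [] :=
    Primrec.option_getD.comp .decode (.const [])
  refine ⟨fun p => (Encodable.decode (α := List Bool) (Nat.find (h p))).getD [],
    fun i σ => Nat.find_spec (h (i, σ)), fun u hu => ?_⟩
  have hfind : OracleComputable u fun p => Nat.find (h p) := by
    refine OracleComputable.find (p := fun q : (ℕ × List Bool) × ℕ =>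
      R (q.1.1, q.1.2, (Encodable.decode (α := List Bool) q.2).getD [])) ?_
      (fun p => Nat.find_spec (h p)) fun p m hm => by simpa using Nat.find_min (h p) hm
    exact hu.comp (.of_primrec ((Primrec.fst.comp .fst).pair
      ((Primrec.snd.comp .fst).pair (hdec.comp .snd))))
  exact (OracleComputable.of_primrec hdec).comp hfind

/-! ### Pointed perfect sets -/

theorem exists_split_of_incomparable {σ τ₁ τ₂ : List Bool} (h₁ : σ <+: τ₁) (h₂ : σ <+: τ₂)
    (h₁₂ : ¬ τ₁ <+: τ₂) (h₂₁ : ¬ τ₂ <+: τ₁) :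
    ∃ ρ, (σ ++ ρ ++ [false] <+: τ₁ ∨ σ ++ ρ ++ [false] <+: τ₂) ∧
      (σ ++ ρ ++ [true] <+: τ₁ ∨ σ ++ ρ ++ [true] <+: τ₂) := by
  obtain ⟨υ₁, rfl⟩ := h₁
  obtain ⟨υ₂, rfl⟩ := h₂
  induction υ₁ generalizing σ υ₂ with
  | nil => simp at h₁₂
  | cons a υ₁ ih =>
    cases υ₂ with
    | nil => simp at h₂₁
    | cons b υ₂ =>
      by_cases hab : a = b
      · subst hab
        obtain ⟨ρ, hρ⟩ := ih (σ := σ ++ [a]) υ₂ (by simpa using h₁₂) (by simpa using h₂₁)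
        exact ⟨a :: ρ, by simpa using hρ⟩
      · refine ⟨[], ?_⟩
        cases a <;> cases b <;> simp_all

theorem codeOfStringSet_encode (T : Set (List Bool)) (σ : List Bool) :
    codeOfStringSet T (Encodable.encode σ) = true ↔ σ ∈ T := by
  simp [codeOfStringSet]

/-- A pointed perfect set contains two different members of every Turing degree in the cone above
its tree. -/
theorem PointedPerfect.exists_cone {P : Set (ℕ → Bool)} (hP : PointedPerfect P) :
    ∃ b, ∀ d, TuringLE b d → ∃ x ∈ P, ∃ y ∈ P, x ≠ y ∧ TuringEquiv x d ∧ TuringEquiv y d := by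
  obtain ⟨T, ⟨hT, hne, hsplit⟩, rfl, hpt⟩ := hP
  have hnil : [] ∈ T := hne.elim fun σ hσ => hT σ hσ [] List.nil_prefix
  let t : List Bool → Bool := fun σ => codeOfStringSet T (Encodable.encode σ)
  have ht σ : t σ = true ↔ σ ∈ T := codeOfStringSet_encode T σ
  let R : ℕ × List Bool × List Bool → Bool := fun q =>
    !t q.2.1 || (t (q.2.1 ++ q.2.2 ++ [false]) && t (q.2.1 ++ q.2.2 ++ [true]))
  have hR i σ : ∃ τ, R (i, σ, τ) = true := by
    by_cases hσ : σ ∈ T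
    · obtain ⟨τ₁, hτ₁, τ₂, hτ₂, h₁, h₂, h₁₂, h₂₁⟩ := hsplit σ hσ
      obtain ⟨ρ, h₀, h₁⟩ := exists_split_of_incomparable h₁ h₂ h₁₂ h₂₁
      refine ⟨ρ, ?_⟩
      have h₀ : σ ++ ρ ++ [false] ∈ T := h₀.elim (hT _ hτ₁ _) (hT _ hτ₂ _)
      have h₁ : σ ++ ρ ++ [true] ∈ T := h₁.elim (hT _ hτ₁ _) (hT _ hτ₂ _)
      simp only [R, (ht _).2 h₀, (ht _).2 h₁, Bool.and_self, Bool.or_true]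
    · exact ⟨[], by simp [R, (ht σ).not.2 hσ]⟩
  have hRu u (hu : TuringLE (codeOfStringSet T) u) : OracleComputable u R := by
    rw [turingLE_iff_oracleComputable] at hu
    have htu : OracleComputable u t := hu.comp (.of_primrec .encode)
    have happ : Primrec fun q : ℕ × List Bool × List Bool => q.2.1 ++ q.2.2 :=
      Primrec.list_append.comp (Primrec.fst.comp .snd) (Primrec.snd.comp .snd)
    exact OracleComputable.comp (f := fun q : Bool × Bool × Bool => !q.1 || (q.2.1 && q.2.2))
      (.of_primrec (Primrec.dom_finite _))
      ((htu.comp (.of_primrec (Primrec.fst.comp .snd))).pair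
        ((htu.comp (.of_primrec (Primrec.list_concat.comp happ (.const false)))).pair
          (htu.comp (.of_primrec (Primrec.list_concat.comp happ (.const true))))))
  obtain ⟨ρ, hρ, hρu⟩ := exists_oracleComputable_strategy hR
  have hmem d n : codingStr ρ [] d n ∈ T := by
    induction n with
    | zero => exact hnil
    | succ n ih =>
      have := hρ n (codingStr ρ [] d n)
      simp only [R, (ht _).2 ih, Bool.not_true, Bool.false_or, Bool.and_eq_true, ht] at this
      rw [codingStr]
      cases d n
      exacts [this.1, this.2]
  have hbranch d : codingReal ρ [] d ∈ branches T := fun k => by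
    have h := initSeg_codingReal ρ [] d (List.prefix_refl (codingStr ρ [] d k))
    refine hT _ (hmem d k) _ ?_
    conv_rhs => rw [← h]
    exact initSeg_prefix _ (le_length_codingStr ρ [] d k)
  have hequiv d (hd : TuringLE (codeOfStringSet T) d) : TuringEquiv (codingReal ρ [] d) d := by
    refine ⟨codingReal_turingLE _ (hρu d (hRu d hd)) (.refl d), ?_⟩
    have := decodingReal_turingLE [] (hρu _ (hRu _ (hpt _ (hbranch d)))) (.refl _)
    rwa [decodingReal_codingReal] at this
  refine ⟨codeOfStringSet T, fun d hd => ?_⟩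
  have hflip (e : ℕ → Bool) : TuringLE (fun n => !e n) e :=
    turingLE_iff_oracleComputable.2 ((OracleComputable.of_primrec Primrec.not).comp .self)
  have hd' : TuringEquiv (fun n => !d n) d := ⟨hflip d, by simpa using hflip fun n => !d n⟩
  refine ⟨_, hbranch d, _, hbranch fun n => !d n, fun h => ?_, hequiv d hd,
    (hequiv _ (hd.trans hd'.2)).trans hd'⟩
  have := congrArg (decodingReal ρ []) h
  rw [decodingReal_codingReal, decodingReal_codingReal] at this
  simpa using congrFun this 0

/-! ### Borel enumeration of the Turing functionals -/

/-- Programs for oracle computations. -/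
inductive OracleCode : Type
  | zero : OracleCode
  | succ : OracleCode
  | left : OracleCode
  | right : OracleCode
  | oracle : OracleCode
  | pair : OracleCode → OracleCode → OracleCode
  | comp : OracleCode → OracleCode → OracleCode
  | prec : OracleCode → OracleCode → OracleCode
  | rfind : OracleCode → OracleCode

namespace OracleCode

/-- The partial function computed by a program with oracle `O`. -/
def eval (O : ℕ → ℕ) : OracleCode → ℕ →. ℕ
  | zero => pure 0
  | succ => fun n => Part.some (Nat.succ n)
  | left => fun n => Part.some (Nat.unpair n).1
  | right => fun n => Part.some (Nat.unpair n).2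
  | oracle => fun n => Part.some (O n)
  | pair c d => fun n => Nat.pair <$> eval O c n <*> eval O d n
  | comp c d => fun n => eval O d n >>= eval O c
  | prec c d => Nat.unpaired fun a n =>
      n.rec (eval O c a) fun y IH => do { let i ← IH; eval O d (Nat.pair a (Nat.pair y i)) }
  | rfind c => fun a => Nat.rfind fun n => (fun m => m = 0) <$> eval O c (Nat.pair a n)

theorem recursiveIn_eval (O : ℕ → ℕ) (c : OracleCode) : RecursiveIn O (c.eval O) := by
  induction c with
  | zero => exact .zero
  | succ => exact .succ
  | left => exact .left
  | right => exact .right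
  | oracle => exact .oracle
  | pair _ _ h₁ h₂ => exact .pair h₁ h₂
  | comp _ _ h₁ h₂ => exact .comp h₁ h₂
  | prec _ _ h₁ h₂ => exact .prec h₁ h₂
  | rfind _ h => exact .rfind h

theorem exists_eval_eq {O : ℕ → ℕ} {f : ℕ →. ℕ} (hf : RecursiveIn O f) :
    ∃ c : OracleCode, c.eval O = f := by
  induction hf with
  | zero => exact ⟨zero, rfl⟩
  | succ => exact ⟨succ, rfl⟩
  | left => exact ⟨left, rfl⟩
  | right => exact ⟨right, rfl⟩
  | oracle => exact ⟨oracle, rfl⟩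
  | pair _ _ h₁ h₂ => obtain ⟨⟨c, rfl⟩, d, rfl⟩ := And.intro h₁ h₂; exact ⟨pair c d, rfl⟩
  | comp _ _ h₁ h₂ => obtain ⟨⟨c, rfl⟩, d, rfl⟩ := And.intro h₁ h₂; exact ⟨comp c d, rfl⟩
  | prec _ _ h₁ h₂ => obtain ⟨⟨c, rfl⟩, d, rfl⟩ := And.intro h₁ h₂; exact ⟨prec c d, rfl⟩
  | rfind _ h => obtain ⟨c, rfl⟩ := h; exact ⟨rfind c, rfl⟩

/-- An injective numbering of the programs. -/
def toNat : OracleCode → ℕ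
  | zero => Nat.pair 0 0
  | succ => Nat.pair 1 0
  | left => Nat.pair 2 0
  | right => Nat.pair 3 0
  | oracle => Nat.pair 4 0
  | pair c d => Nat.pair 5 (Nat.pair c.toNat d.toNat)
  | comp c d => Nat.pair 6 (Nat.pair c.toNat d.toNat)
  | prec c d => Nat.pair 7 (Nat.pair c.toNat d.toNat)
  | rfind c => Nat.pair 8 c.toNat

theorem toNat_injective : Function.Injective toNat := by
  intro c
  induction c with
  | zero | succ | left | right | oracle =>
    intro d h; cases d <;> simp_all [toNat]
  | pair _ _ h₁ h₂ | comp _ _ h₁ h₂ | prec _ _ h₁ h₂ =>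
    intro d h
    cases d <;> simp [toNat] at h
    rw [h₁ h.1, h₂ h.2]
  | rfind _ h₁ =>
    intro d h
    cases d <;> simp [toNat] at h
    rw [h₁ h]

instance : Countable OracleCode := toNat_injective.countable

theorem measurableSet_mem_eval (c : OracleCode) (n v : ℕ) :
    MeasurableSet {x : ℕ → Bool | v ∈ c.eval (oracleOf x) n} := by
  induction c generalizing n v with
  | zero | succ | left | right => simp only [eval]; exact .const _
  | oracle =>
    have h : MeasurableSet {x : ℕ → Bool | v = cond (x n) 1 0} :=
      measurableSet_eq_fun measurable_const
        ((measurable_from_top (f := fun b : Bool => cond b 1 0)).comp (measurable_pi_apply n))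
    simpa [eval, oracleOf] using h
  | pair c d hc hd =>
    have : {x : ℕ → Bool | v ∈ (pair c d).eval (oracleOf x) n} =
        ⋃ (i : ℕ) (j : ℕ) (_ : v = Nat.pair i j),
          {x | i ∈ c.eval (oracleOf x) n} ∩ {x | j ∈ d.eval (oracleOf x) n} := by
      ext x
      simp [eval, Seq.seq]
      grind
    rw [this]
    exact .iUnion fun i => .iUnion fun j => .iUnion fun _ => (hc n i).inter (hd n j)
  | comp c d hc hd =>
    have : {x : ℕ → Bool | v ∈ (comp c d).eval (oracleOf x) n} =
        ⋃ i : ℕ, {x | i ∈ d.eval (oracleOf x) n} ∩ {x | v ∈ c.eval (oracleOf x) i} := by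
      ext x
      simp only [Set.mem_ofPred_eq, Set.mem_iUnion, Set.mem_inter_iff]
      exact Part.mem_bind_iff
    rw [this]
    exact .iUnion fun i => (hd n i).inter (hc i v)
  | prec c d hc hd =>
    simp only [eval, Nat.unpaired]
    induction (Nat.unpair n).2 generalizing v with
    | zero => exact hc _ v
    | succ k ih =>
      simp only [Part.bind_eq_bind, Part.mem_bind_iff, Set.ofPred_exists]
      exact .iUnion fun i => (ih i).inter (hd _ v)
  | rfind c hc =>
    have : {x : ℕ → Bool | v ∈ (rfind c).eval (oracleOf x) n} =
        {x | 0 ∈ c.eval (oracleOf x) (Nat.pair n v)} ∩ ⋂ (m : ℕ) (_ : m < v), ⋃ i : ℕ,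
          {x | i + 1 ∈ c.eval (oracleOf x) (Nat.pair n m)} := by
      ext x
      simp only [Set.mem_ofPred_eq, Set.mem_iInter, Set.mem_iUnion, Set.mem_inter_iff]
      refine Nat.mem_rfind.trans (and_congr ?_ (forall₂_congr fun m _ => ?_))
      · simp
      · simp only [Part.map_eq_map, Part.mem_map_iff, decide_eq_false_iff_not]
        exact ⟨fun ⟨a, ha, h⟩ => ⟨a - 1, by rwa [Nat.sub_add_cancel (Nat.pos_of_ne_zero h)]⟩,
          fun ⟨i, hi⟩ => ⟨_, hi, by simp⟩⟩
    rw [this]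
    exact (hc _ 0).inter (.iInter fun m => .iInter fun _ => .iUnion fun i => hc _ (i + 1))

end OracleCode

theorem measurableSet_apply_eq (n : ℕ) (b : Bool) : MeasurableSet {x : ℕ → Bool | x n = b} :=
  measurableSet_eq_fun (measurable_pi_apply n) measurable_const

/-- The reals computable from `x` can be enumerated by Borel functions of `x`. -/
theorem exists_measurable_turing_enumeration :
    ∃ φ : ℕ → (ℕ → Bool) → ℕ → Bool, (∀ e, Measurable (φ e)) ∧
      ∀ z x, TuringLE z x ↔ ∃ e, z = φ e x := by
  have : Nonempty OracleCode := ⟨.zero⟩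
  obtain ⟨c, hc⟩ := exists_surjective_nat OracleCode
  let S e : Set (ℕ → Bool) :=
    {x | ∀ n, 0 ∈ (c e).eval (oracleOf x) n ∨ 1 ∈ (c e).eval (oracleOf x) n}
  have hS e : MeasurableSet (S e) := by
    simp only [S, Set.ofPred_forall, Set.ofPred_or]
    exact .iInter fun n => (OracleCode.measurableSet_mem_eval _ _ _).union
      (OracleCode.measurableSet_mem_eval _ _ _)
  let φ e x : ℕ → Bool := fun n => decide (x ∈ S e ∧ 1 ∈ (c e).eval (oracleOf x) n)
  refine ⟨φ, fun e => measurable_pi_lambda _ fun n => measurable_to_bool ?_, fun z x => ⟨?_, ?_⟩⟩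
  · have : (fun x => φ e x n) ⁻¹' {true} = S e ∩ {x | 1 ∈ (c e).eval (oracleOf x) n} := by
      ext x; simp [φ]
    rw [this]
    exact (hS e).inter (OracleCode.measurableSet_mem_eval _ _ _)
  · intro h
    obtain ⟨p, hp⟩ := OracleCode.exists_eval_eq h
    obtain ⟨e, rfl⟩ := hc p
    have hxS : x ∈ S e := fun n => by
      simp only [hp, oracleOf]
      cases z n <;> simp
    refine ⟨e, funext fun n => ?_⟩
    simp only [φ, hxS, true_and, hp, oracleOf]
    cases z n <;> simp
  · rintro ⟨e, rfl⟩
    by_cases hx : x ∈ S e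
    · have : (fun n => Part.some (oracleOf (φ e x) n)) = (c e).eval (oracleOf x) := by
        funext n
        simp only [oracleOf, φ, hx, true_and]
        by_cases h : 1 ∈ (c e).eval (oracleOf x) n
        · simpa [h] using (Part.eq_some_iff.2 h).symm
        · simpa [h] using (Part.eq_some_iff.2 ((hx n).resolve_right h)).symm
      rw [TuringLE, this]
      exact OracleCode.recursiveIn_eval _ _
    · have : φ e x = fun _ => false := by
        funext n; simp [φ, hx]
      rw [this, turingLE_iff_oracleComputable]
      exact .of_primrec (.const false)

theorem measurableSet_turingLE :
    MeasurableSet {p : (ℕ → Bool) × (ℕ → Bool) | TuringLE p.1 p.2} := by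
  obtain ⟨φ, hφ, h⟩ := exists_measurable_turing_enumeration
  simp only [h, Set.ofPred_exists]
  exact .iUnion fun e => measurableSet_eq_fun measurable_fst ((hφ e).comp measurable_snd)

theorem measurableSet_turingEquiv :
    MeasurableSet {p : (ℕ → Bool) × (ℕ → Bool) | TuringEquiv p.1 p.2} :=
  measurableSet_turingLE.inter (measurable_swap measurableSet_turingLE)

/-! ### Cohen forcing for Borel sets -/

/-- Membership of `c ⊕ x` in `B` is decided, in a Borel way uniformly in `c`, by initial segments
of `x`, provided that `x` meets countably many dense sets of strings: `W` and `V` are the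
strings forcing membership and non-membership, and `D` are the dense sets. -/
def ForcingDecidable (B : Set (ℕ → Bool)) : Prop :=
  ∃ (W V : List Bool → Set (ℕ → Bool)) (D : ℕ → List Bool → Set (ℕ → Bool)),
    (∀ σ, MeasurableSet (W σ)) ∧ (∀ σ, MeasurableSet (V σ)) ∧ (∀ i σ, MeasurableSet (D i σ)) ∧
    (∀ c i σ, ∃ τ, c ∈ D i (σ ++ τ)) ∧
    ∀ c x, (∀ i, ∃ k, c ∈ D i (initSeg x k)) →
      (join c x ∈ B ↔ ∃ k, c ∈ W (initSeg x k)) ∧ (join c x ∉ B ↔ ∃ k, c ∈ V (initSeg x k))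

theorem initSeg_getElem? (x : ℕ → Bool) (k j : ℕ) :
    (initSeg x k)[j]? = if j < k then some (x j) else none := by
  simp only [initSeg, List.getElem?_map]
  split_ifs with h <;> simp [h]

theorem forcingDecidable_apply_mem (n : ℕ) (S : Set Bool) :
    ForcingDecidable {z | z n ∈ S} := by
  have hS : Measurable fun b : Bool => b ∈ S := measurable_from_top
  cases hn : n.bodd with
  | false =>
    have h : MeasurableSet {c : ℕ → Bool | c n.div2 ∈ S} :=
      measurableSet_setOfPred.2 (hS.comp (measurable_pi_apply _))
    refine ⟨fun _ => {c | c n.div2 ∈ S}, fun _ => {c | c n.div2 ∈ S}ᶜ, fun _ _ => Set.univ,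
      fun _ => h, fun _ => h.compl, fun _ _ => .univ, fun _ _ _ => ⟨[], trivial⟩,
      fun c x _ => ⟨?_, ?_⟩⟩ <;> simp [join, hn]
  | true =>
    refine ⟨fun σ => {_c | ∃ b ∈ S, σ[n.div2]? = some b},
      fun σ => {_c | ∃ b ∉ S, σ[n.div2]? = some b}, fun _ _ => Set.univ,
      fun _ => .const _, fun _ => .const _, fun _ _ => .univ, fun _ _ _ => ⟨[], trivial⟩,
      fun c x _ => ⟨?_, ?_⟩⟩
    all_goals
      simp only [Set.mem_ofPred_eq, join, hn, cond_true, initSeg_getElem?]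
      constructor
      · exact fun h => ⟨n.div2 + 1, _, h, by simp⟩
      · rintro ⟨k, b, hb, h⟩
        split_ifs at h
        obtain rfl := Option.some.inj h
        exact hb

theorem ForcingDecidable.empty : ForcingDecidable ∅ :=
  ⟨fun _ => ∅, fun _ => Set.univ, fun _ _ => Set.univ, fun _ => .empty, fun _ => .univ,
    fun _ _ => .univ, fun _ _ _ => ⟨[], trivial⟩, fun c x _ => by simp⟩

theorem ForcingDecidable.compl {B : Set (ℕ → Bool)} (h : ForcingDecidable B) :
    ForcingDecidable Bᶜ := by
  obtain ⟨W, V, D, hW, hV, hD, hdense, hdec⟩ := h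
  refine ⟨V, W, D, hV, hW, hD, hdense, fun c x hx => ?_⟩
  simpa using (hdec c x hx).symm

theorem ForcingDecidable.iUnion {B : ℕ → Set (ℕ → Bool)} (h : ∀ n, ForcingDecidable (B n)) :
    ForcingDecidable (⋃ n, B n) := by
  choose W V D hW hV hD hdense hdec using h
  let W' σ : Set (ℕ → Bool) := ⋃ n, W n σ
  have hW' σ : MeasurableSet (W' σ) := .iUnion fun n => hW n σ
  let V' σ : Set (ℕ → Bool) := (⋃ τ, W' (σ ++ τ)) ∪ ⋃ (τ) (_ : τ <+: σ), W' τ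
  have hV' σ : MeasurableSet (V' σ) :=
    .union (.iUnion fun τ => hW' _) (.iUnion fun τ => .iUnion fun _ => hW' τ)
  let D' : ℕ → List Bool → Set (ℕ → Bool)
    | 0, σ => (⋃ (τ) (_ : τ <+: σ), W' τ) ∪ (V' σ)ᶜ
    | i + 1, σ => D i.unpair.1 i.unpair.2 σ
  refine ⟨W', fun σ => (V' σ)ᶜ, D', hW', fun σ => (hV' σ).compl, ?_, ?_, fun c x hx => ?_⟩
  · rintro (_ | i) σ
    · exact .union (.iUnion fun τ => .iUnion fun _ => hW' τ) (hV' σ).compl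
    · exact hD _ _ _
  · rintro c (_ | i) σ
    · by_cases hc : ∃ τ, c ∈ W' (σ ++ τ)
      · obtain ⟨τ, hτ⟩ := hc
        refine ⟨τ, .inl ?_⟩
        simp only [Set.mem_iUnion]
        exact ⟨_, List.prefix_rfl, hτ⟩
      · refine ⟨[], ?_⟩
        rw [List.append_nil]
        by_cases hp : ∃ τ, τ <+: σ ∧ c ∈ W' τ
        · left
          simpa only [Set.mem_iUnion, exists_prop] using hp
        · right
          simp only [V', Set.mem_compl_iff, Set.mem_union,
            Set.mem_iUnion (s := fun τ => W' (σ ++ τ)),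
            Set.mem_iUnion (s := fun τ => ⋃ (_ : τ <+: σ), W' τ),
            Set.mem_iUnion (ι := _ <+: σ), exists_prop]
          exact not_or.2 ⟨hc, hp⟩
    · exact hdense _ _ _ _
  · have hgen n i : ∃ k, c ∈ D n i (initSeg x k) := by
      simpa [D'] using hx (Nat.pair n i + 1)
    have hmem : join c x ∈ ⋃ n, B n ↔ ∃ k, c ∈ W' (initSeg x k) := by
      simp only [W', Set.mem_iUnion, fun n => (hdec n c x (hgen n)).1]
      exact exists_comm
    refine ⟨hmem, ?_⟩
    rw [hmem]
    constructor
    · intro hno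
      obtain ⟨k, hk⟩ := hx 0
      refine ⟨k, hk.resolve_left fun hk => hno ?_⟩
      simp only [Set.mem_iUnion (s := fun τ => ⋃ (_ : τ <+: initSeg x k), W' τ),
        Set.mem_iUnion (ι := _ <+: initSeg x k), exists_prop] at hk
      obtain ⟨τ, hτ, hc⟩ := hk
      exact ⟨τ.length, eq_initSeg_of_prefix hτ ▸ hc⟩
    · rintro ⟨k, hk⟩ ⟨l, hl⟩
      refine hk ?_
      rcases le_total k l with h | h
      · left
        obtain ⟨τ, hτ⟩ := initSeg_prefix x h
        exact Set.mem_iUnion.2 ⟨τ, hτ ▸ hl⟩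
      · right
        exact Set.mem_iUnion.2 ⟨_, Set.mem_iUnion.2 ⟨initSeg_prefix x h, hl⟩⟩

theorem forcingDecidable_of_measurableSet {B : Set (ℕ → Bool)} (hB : MeasurableSet B) :
    ForcingDecidable B := by
  let m : MeasurableSpace (ℕ → Bool) :=
    { MeasurableSet' := ForcingDecidable
      measurableSet_empty := .empty
      measurableSet_compl := fun _ h => h.compl
      measurableSet_iUnion := fun _ h => .iUnion h }
  have hm : MeasurableSpace.pi ≤ m := by
    refine iSup_le fun n => ?_
    rintro _ ⟨S, -, rfl⟩
    exact forcingDecidable_apply_mem n S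
  exact hm B hB

/-- A set of reals containing a real that meets any given countably many dense sets of strings;
for Borel sets, this says that the set is not meager. -/
def CohenLarge (X : Set (ℕ → Bool)) : Prop :=
  ∀ D : ℕ → List Bool → Prop, (∀ i σ, ∃ τ, D i (σ ++ τ)) → ∃ x ∈ X, ∀ i, ∃ k, D i (initSeg x k)

theorem CohenLarge.or_of_union {X Y : Set (ℕ → Bool)} (h : CohenLarge (X ∪ Y)) :
    CohenLarge X ∨ CohenLarge Y := by
  by_contra! hXY
  simp only [CohenLarge] at hXY
  push Not at hXY
  obtain ⟨⟨D, hD, hX⟩, E, hE, hY⟩ := hXY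
  obtain ⟨x, hx, hgen⟩ := h (fun i => cond i.bodd (D i.div2) (E i.div2)) fun i σ => by
    cases i.bodd
    exacts [hE _ σ, hD _ σ]
  rcases hx with hx | hx
  · obtain ⟨i, hi⟩ := hX x hx
    obtain ⟨k, hk⟩ := hgen (2 * i + 1)
    refine hi k ?_
    simpa [Nat.div2_val, show (2 * i + 1) / 2 = i by omega] using hk
  · obtain ⟨i, hi⟩ := hY x hx
    obtain ⟨k, hk⟩ := hgen (2 * i)
    refine hi k ?_
    simpa using hk

/-- The real built along a strategy for meeting the sets of strings `D i` meets all of them. -/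
theorem exists_mem_initSeg_codingReal {D : ℕ → List Bool → Prop} {ρ : ℕ × List Bool → List Bool}
    (hρ : ∀ i σ, D i (σ ++ ρ (i, σ))) (σ₀ : List Bool) (d : ℕ → Bool) (i : ℕ) :
    ∃ k, D i (initSeg (codingReal ρ σ₀ d) k) := by
  refine ⟨(codingStr ρ σ₀ d i ++ ρ (i, codingStr ρ σ₀ d i)).length, ?_⟩
  rw [initSeg_codingReal ρ σ₀ d (m := i + 1) (List.prefix_append _ _)]
  exact hρ _ _

theorem CohenLarge.univ : CohenLarge Set.univ := fun D hD => by
  choose τ hτ using hD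
  exact ⟨_, trivial, exists_mem_initSeg_codingReal (ρ := fun p => τ p.1 p.2) hτ [] fun _ => false⟩


/-! ### A Turing invariant Borel jump -/

/-- A version of `ForcingDecidable` with a single family of Borel sets: `K 0` are the strings
forcing membership, `K 1` those forcing non-membership, and `K (i + 2)` are the dense sets. -/
theorem exists_forcing_family (B : {B : Set (ℕ → Bool) // MeasurableSet B}) :
    ∃ K : ℕ → List Bool → {B : Set (ℕ → Bool) // MeasurableSet B},
      (∀ c i σ, ∃ τ, c ∈ (K (i + 2) (σ ++ τ)).1) ∧
      ∀ c x, (∀ i, ∃ k, c ∈ (K (i + 2) (initSeg x k)).1) →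
        (join c x ∈ B.1 ↔ ∃ k, c ∈ (K 0 (initSeg x k)).1) ∧
        (join c x ∉ B.1 ↔ ∃ k, c ∈ (K 1 (initSeg x k)).1) := by
  obtain ⟨W, V, D, hW, hV, hD, hdense, hdec⟩ := forcingDecidable_of_measurableSet B.2
  let K : ℕ → List Bool → {B : Set (ℕ → Bool) // MeasurableSet B}
    | 0, σ => ⟨W σ, hW σ⟩
    | 1, σ => ⟨V σ, hV σ⟩
    | i + 2, σ => ⟨D i σ, hD i σ⟩
  exact ⟨K, hdense, hdec⟩

theorem initSeg_oracleComputable (x : ℕ → Bool) : OracleComputable x (initSeg x) := by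
  have h : OracleComputable x fun p : ℕ × List Bool => (p.2, x p.1) :=
    (OracleComputable.of_primrec .snd).pair (OracleComputable.self.comp (.of_primrec .fst))
  refine OracleComputable.iterate (h := fun p : ℕ × List Bool => p.2 ++ [x p.1])
    (OracleComputable.comp (f := fun q : List Bool × Bool => q.1 ++ [q.2])
      (.of_primrec Primrec.list_concat) h) fun n => ?_
  simp [initSeg, List.range_succ]

/-- For every Borel set `D` there is a Turing invariant Borel operator `J` such that, whenever the
section of `D` at `c` is large, the members of this section can be chosen so that `J` takes any
prescribed Turing degree above that of `J c` at their join with `c`. -/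
theorem exists_jump {D : Set (ℕ → Bool)} (hD : MeasurableSet D) :
    ∃ J : (ℕ → Bool) → ℕ → Bool, Measurable J ∧
      (∀ z z', TuringEquiv z z' → TuringEquiv (J z) (J z')) ∧
      ∀ c, CohenLarge {x | join c x ∈ D} → ∀ d, TuringLE (J c) d →
        ∃ x, join c x ∈ D ∧ TuringEquiv (J (join c x)) d := by
  obtain ⟨φ, hφ, hφ_iff⟩ := exists_measurable_turing_enumeration
  choose K hdense hdec using exists_forcing_family
  let op : ℕ ⊕ ℕ ⊕ (ℕ × List Bool) → {B : Set (ℕ → Bool) // MeasurableSet B} →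
      {B : Set (ℕ → Bool) // MeasurableSet B}
    | .inl k, _ => ⟨{z | z k = true}, measurableSet_apply_eq k true⟩
    | .inr (.inl e), B => ⟨φ e ⁻¹' B.1, hφ e B.2⟩
    | .inr (.inr (i, σ)), B => K B i σ
  let B : List (ℕ ⊕ ℕ ⊕ (ℕ × List Bool)) → {B : Set (ℕ → Bool) // MeasurableSet B} :=
    fun l => l.foldr op ⟨D, hD⟩
  let j : (ℕ → Bool) → List (ℕ ⊕ ℕ ⊕ (ℕ × List Bool)) → Bool := fun z l => decide (z ∈ (B l).1)
  have hj z l : j z l = true ↔ z ∈ (B l).1 := decide_eq_true_iff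
  let J : (ℕ → Bool) → ℕ → Bool := fun z n => j z ((Encodable.decode n).getD [])
  have hJ_meas : Measurable J := measurable_pi_iff.2 fun n =>
    measurable_to_bool <| by
      convert (B ((Encodable.decode n).getD [])).2 using 1
      ext z
      exact hj z _
  have hjJ z : OracleComputable (J z) (j z) := by
    have := (OracleComputable.self (x := J z)).comp
      (.of_primrec (Primrec.encode (α := List (ℕ ⊕ ℕ ⊕ (ℕ × List Bool)))))
    simpa [J] using this
  have hJj {z u} (h : OracleComputable u (j z)) : TuringLE (J z) u :=
    turingLE_iff_oracleComputable.2 <| h.comp <| .of_primrec <|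
      Primrec.option_getD.comp .decode (.const [])
  have hle z : TuringLE z (J z) := by
    refine turingLE_iff_oracleComputable.2 ?_
    have h : Primrec fun n : ℕ => ([.inl n] : List (ℕ ⊕ ℕ ⊕ (ℕ × List Bool))) :=
      Primrec.list_cons.comp .sumInl (.const [])
    convert (hjJ z).comp (.of_primrec h) using 2 with n
    exact (Bool.eq_iff_iff.2 (hj z [.inl n])).symm
  have hmono {z z'} (h : TuringLE z' z) : TuringLE (J z') (J z) := by
    obtain ⟨e, rfl⟩ := (hφ_iff _ _).1 h
    have h : Primrec fun l : List (ℕ ⊕ ℕ ⊕ (ℕ × List Bool)) => .inr (.inl e) :: l :=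
      Primrec.list_cons.comp (.const _) .id
    exact hJj ((hjJ z).comp (.of_primrec h))
  refine ⟨J, hJ_meas, fun z z' h => ⟨hmono h.1, hmono h.2⟩, fun c hc d hd => ?_⟩
  let q : ℕ → List (ℕ ⊕ ℕ ⊕ (ℕ × List Bool)) × ℕ := fun n => (Encodable.decode n).getD ([], 0)
  have hq : Primrec q := Primrec.option_getD.comp .decode (.const _)
  have hforce (i : ℕ) : Primrec fun p : List (ℕ ⊕ ℕ ⊕ (ℕ × List Bool)) × List Bool =>
      .inr (.inr (i, p.2)) :: p.1 :=
    Primrec.list_cons.comp (Primrec.sumInr.comp (Primrec.sumInr.comp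
      (.pair (.const i) .snd))) .fst
  have hcover {x : ℕ → Bool}
      (hx : ∀ n, ∃ k, c ∈ (K (B (q n).1) ((q n).2 + 2) (initSeg x k)).1) l i :
      ∃ k, c ∈ (K (B l) (i + 2) (initSeg x k)).1 := by
    simpa [q] using hx (Encodable.encode (l, i))
  have hj_force l i σ : j c (.inr (.inr (i, σ)) :: l) = true ↔ c ∈ (K (B l) i σ).1 := hj _ _
  have hgen {x : ℕ → Bool} (hx : ∀ l i, ∃ k, c ∈ (K (B l) (i + 2) (initSeg x k)).1) {u}
      (hxu : TuringLE x u) (hu : TuringLE (J c) u) : TuringLE (J (join c x)) u := by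
    have hju : OracleComputable u (j c) := (hjJ c).of_turingLE hu
    let p (i : ℕ) (r : List (ℕ ⊕ ℕ ⊕ (ℕ × List Bool)) × ℕ) : Bool :=
      j c (.inr (.inr (i, initSeg x r.2)) :: r.1)
    have hp i : OracleComputable u (p i) :=
      (hju.comp (.of_primrec (hforce i))).comp ((OracleComputable.of_primrec .fst).pair
        (((initSeg_oracleComputable x).of_turingLE hxu).comp (.of_primrec .snd)))
    have hp0 l : join c x ∈ (B l).1 ↔ ∃ k, p 0 (l, k) = true := by
      simpa only [p, hj_force] using (hdec (B l) c x (hx l)).1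
    have hp1 l : join c x ∉ (B l).1 ↔ ∃ k, p 1 (l, k) = true := by
      simpa only [p, hj_force] using (hdec (B l) c x (hx l)).2
    have hex l : ∃ k, (p 0 (l, k) || p 1 (l, k)) = true := by
      simp only [Bool.or_eq_true, exists_or, ← hp0, ← hp1]
      exact em _
    have hfind : OracleComputable u fun l => Nat.find (hex l) :=
      .find (p := fun r => p 0 r || p 1 r)
        (OracleComputable.comp (f := fun q : Bool × Bool => q.1 || q.2)
          (.of_primrec Primrec.or) ((hp 0).pair (hp 1)))
        (fun l => Nat.find_spec (hex l)) fun l m hm => by simpa using Nat.find_min (hex l) hm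
    refine hJj ?_
    convert (hp 0).comp ((OracleComputable.of_primrec .id).pair hfind) using 2 with l
    rw [Bool.eq_iff_iff, hj, id, hp0]
    refine ⟨fun h => ?_, fun h => ⟨_, h⟩⟩
    have := Nat.find_spec (hex l)
    rw [Bool.or_eq_true] at this
    exact this.resolve_right fun h' => (hp1 l).2 ⟨_, h'⟩ ((hp0 l).2 h)
  let R : ℕ × List Bool × List Bool → Bool := fun r =>
    j c (.inr (.inr ((q r.1).2 + 2, r.2.1 ++ r.2.2)) :: (q r.1).1)
  have hR r : R r = true ↔ c ∈ (K (B (q r.1).1) ((q r.1).2 + 2) (r.2.1 ++ r.2.2)).1 :=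
    hj_force _ _ _
  obtain ⟨ρ, hρ, hρu⟩ := exists_oracleComputable_strategy (R := R)
    fun n σ => (hdense (B (q n).1) c (q n).2 σ).imp fun τ => (hR (n, σ, τ)).2
  have hRu {u} (hu : TuringLE (J c) u) : OracleComputable u ρ := by
    refine hρu u (((hjJ c).of_turingLE hu).comp (.of_primrec ?_))
    have hq1 : Primrec fun r : ℕ × List Bool × List Bool => q r.1 := hq.comp .fst
    exact Primrec.list_cons.comp (Primrec.sumInr.comp (Primrec.sumInr.comp
      (.pair (Primrec.succ.comp (Primrec.succ.comp (Primrec.snd.comp hq1)))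
        (Primrec.list_append.comp (Primrec.fst.comp .snd) (Primrec.snd.comp .snd)))))
      (Primrec.fst.comp hq1)
  obtain ⟨y, hyD, hy⟩ := hc (fun n σ => c ∈ (K (B (q n).1) ((q n).2 + 2) σ).1)
    fun n => hdense _ _ _
  obtain ⟨k, hk⟩ := (hdec (B []) c y (hcover hy [])).1.1 hyD
  let x := codingReal ρ (initSeg y k) d
  have hx : ∀ l i, ∃ k, c ∈ (K (B l) (i + 2) (initSeg x k)).1 :=
    hcover (exists_mem_initSeg_codingReal
      (D := fun n σ => c ∈ (K (B (q n).1) ((q n).2 + 2) σ).1) (fun n σ => (hR _).1 (hρ n σ)) _ _)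
  have hxd : TuringLE x d := codingReal_turingLE _ (hRu hd) (.refl d)
  refine ⟨x, (hdec (B []) c x (hx [])).1.2 ⟨(initSeg y k).length, ?_⟩, hgen hx hxd hd, ?_⟩
  · rw [initSeg_codingReal ρ (initSeg y k) d (σ := initSeg y k) (m := 0) List.prefix_rfl]
    exact hk
  · have := decodingReal_turingLE (initSeg y k) (hRu (hmono (left_turingLE_join c x)))
      ((right_turingLE_join c x).trans (hle _))
    rwa [decodingReal_codingReal] at this

/-! ### Borel Turing determinacy from non-approximability -/

/-- If Turing equivalence is an increasing union of Borel equivalence relations, then one of them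
agrees with Turing equivalence on a pointed perfect set. -/
def TuringNonapproximable : Prop :=
  ∀ En : ℕ → (ℕ → Bool) → (ℕ → Bool) → Prop,
    (∀ n, Equivalence (En n)) →
    (∀ n, MeasurableSet {p : (ℕ → Bool) × (ℕ → Bool) | En n p.1 p.2}) →
    (∀ n a b, En n a b → En (n + 1) a b) →
    (∀ a b, TuringEquiv a b ↔ ∃ n, En n a b) →
    ∃ P : Set (ℕ → Bool), PointedPerfect P ∧
      ∃ i, ∀ a ∈ P, ∀ b ∈ P, (En i a b ↔ TuringEquiv a b)

/-- A set of reals closed under Turing equivalence. -/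
def TuringInvariant (A : Set (ℕ → Bool)) : Prop :=
  ∀ x y, TuringEquiv x y → x ∈ A → y ∈ A

theorem TuringInvariant.mem_iff {A : Set (ℕ → Bool)} (hA : TuringInvariant A) {x y : ℕ → Bool}
    (h : TuringEquiv x y) : x ∈ A ↔ y ∈ A :=
  ⟨hA x y h, hA y x h.symm⟩

theorem TuringInvariant.compl {A : Set (ℕ → Bool)} (hA : TuringInvariant A) :
    TuringInvariant Aᶜ :=
  fun _ _ h hx hy => hx (hA _ _ h.symm hy)

theorem TuringInvariant.inter {A A' : Set (ℕ → Bool)} (hA : TuringInvariant A)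
    (hA' : TuringInvariant A') : TuringInvariant (A ∩ A') :=
  fun _ _ h hx => ⟨hA _ _ h hx.1, hA' _ _ h hx.2⟩

/-- A set of reals cofinal in the Turing degrees. -/
def TuringCofinal (A : Set (ℕ → Bool)) : Prop :=
  ∀ b, ∃ x ∈ A, TuringLE b x

theorem TuringCofinal.mono {A A' : Set (ℕ → Bool)} (hA : TuringCofinal A) (h : A ⊆ A') :
    TuringCofinal A' :=
  fun b => (hA b).imp fun _ hx => ⟨h hx.1, hx.2⟩

/-- A set of reals cofinally many of whose sections are large. -/
def CohenCofinal (C : Set (ℕ → Bool)) : Prop :=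
  TuringCofinal {c | CohenLarge {x | join c x ∈ C}}

theorem CohenCofinal.or_of_union {X Y : Set (ℕ → Bool)} (h : CohenCofinal (X ∪ Y)) :
    CohenCofinal X ∨ CohenCofinal Y := by
  by_contra! hXY
  simp only [CohenCofinal, TuringCofinal] at hXY
  push Not at hXY
  obtain ⟨⟨b, hX⟩, b', hY⟩ := hXY
  obtain ⟨c, hc, hbc⟩ := h (join b b')
  rcases CohenLarge.or_of_union (hc : CohenLarge ({x | join c x ∈ X} ∪ {x | join c x ∈ Y}))
    with hc | hc
  · exact hX c hc ((left_turingLE_join b b').trans hbc)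
  · exact hY c hc ((right_turingLE_join b b').trans hbc)

namespace TuringNonapproximable

/-- If an increasing sequence of Turing invariant Borel sets covers the reals, then one of them
contains a Turing cone. -/
theorem exists_not_turingCofinal_compl (h : TuringNonapproximable)
    {B : ℕ → Set (ℕ → Bool)} (hB : ∀ n, MeasurableSet (B n))
    (hinv : ∀ n, TuringInvariant (B n)) (hmono : ∀ n, B n ⊆ B (n + 1)) (hcover : ⋃ n, B n = .univ) :
    ∃ n, ¬ TuringCofinal (B n)ᶜ := by
  have hcover x : ∃ n, x ∈ B n := Set.mem_iUnion.1 (hcover ▸ trivial)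
  let E (n : ℕ) (x y : ℕ → Bool) : Prop := TuringEquiv x y ∧ (x ∈ B n ∨ x = y)
  have hE n : Equivalence (E n) := by
    refine ⟨fun x => ⟨.refl x, .inr rfl⟩, ?_, ?_⟩
    · rintro x y ⟨hxy, hx | rfl⟩
      exacts [⟨hxy.symm, .inl (hinv n _ _ hxy hx)⟩, ⟨hxy, .inr rfl⟩]
    · rintro x y z ⟨hxy, hx | rfl⟩ hyz
      exacts [⟨hxy.trans hyz.1, .inl hx⟩, hyz]
  have hE_meas n : MeasurableSet {p : (ℕ → Bool) × (ℕ → Bool) | E n p.1 p.2} :=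
    measurableSet_turingEquiv.inter
      ((measurable_fst (hB n)).union (measurableSet_eq_fun measurable_fst measurable_snd))
  have hE_union x y : TuringEquiv x y ↔ ∃ n, E n x y := by
    refine ⟨fun hxy => ?_, fun ⟨_, hxy⟩ => hxy.1⟩
    obtain ⟨n, hn⟩ := hcover x
    exact ⟨n, hxy, .inl hn⟩
  obtain ⟨P, hP, i, hi⟩ := h E hE hE_meas
    (fun n x y hxy => ⟨hxy.1, hxy.2.imp_left (hmono n ·)⟩) hE_union
  obtain ⟨b, hb⟩ := hP.exists_cone
  refine ⟨i, fun hi' => ?_⟩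
  obtain ⟨d, hd, hbd⟩ := hi' b
  obtain ⟨x, hx, y, hy, hne, hxd, hyd⟩ := hb d hbd
  exact hd (hinv i _ _ hxd (((hi x hx y hy).2 (hxd.trans hyd.symm)).2.resolve_right hne))

/-- Some Turing invariant Borel set with cofinally many large sections cannot be split into two
cofinal Turing invariant Borel sets. -/
theorem exists_atom (h : TuringNonapproximable) :
    ∃ C, MeasurableSet C ∧ TuringInvariant C ∧ CohenCofinal C ∧
    ∀ X, MeasurableSet X → TuringInvariant X →
      ¬ TuringCofinal (C ∩ X) ∨ ¬ TuringCofinal (C ∩ Xᶜ) := by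
  by_contra! hno
  have hstep (C : {C // MeasurableSet C ∧ TuringInvariant C ∧ CohenCofinal C}) :
      ∃ C' : {C // MeasurableSet C ∧ TuringInvariant C ∧ CohenCofinal C},
        C'.1 ⊆ C.1 ∧ TuringCofinal (C.1 \ C'.1) := by
    obtain ⟨C, hC, hinv, hcof⟩ := C
    obtain ⟨X, hX, hXinv, h₁, h₂⟩ := hno C hC hinv hcof
    rw [← Set.inter_union_compl C X] at hcof
    rcases hcof.or_of_union with hcof | hcof
    · exact ⟨⟨_, hC.inter hX, hinv.inter hXinv, hcof⟩, Set.inter_subset_left,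
        h₂.mono fun x hx => ⟨hx.1, fun hx' => hx.2 hx'.2⟩⟩
    · exact ⟨⟨_, hC.inter hX.compl, hinv.inter hXinv.compl, hcof⟩, Set.inter_subset_left,
        h₁.mono fun x hx => ⟨hx.1, fun hx' => hx'.2 hx.2⟩⟩
  choose next hsub hdiff using hstep
  let C (n : ℕ) := next^[n] ⟨.univ, .univ, fun _ _ _ _ => trivial,
    fun b => ⟨b, CohenLarge.univ, .refl b⟩⟩
  have hC n : C (n + 1) = next (C n) := Function.iterate_succ_apply' _ _ _
  let B (n : ℕ) := (C n).1ᶜ ∪ ⋂ k, (C k).1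
  have hB_inv n : TuringInvariant (B n) := by
    rintro x y hxy (hx | hx)
    · exact .inl ((C n).2.2.1.compl _ _ hxy hx)
    · exact .inr (Set.mem_iInter.2 fun k => (C k).2.2.1 _ _ hxy (Set.mem_iInter.1 hx k))
  have hB_mono n : B n ⊆ B (n + 1) :=
    Set.union_subset_union_left _ (Set.compl_subset_compl.2 (hC n ▸ hsub _))
  have hB_cover : ⋃ n, B n = .univ := by
    refine Set.eq_univ_of_forall fun x => Set.mem_iUnion.2 ?_
    by_cases hx : ∀ k, x ∈ (C k).1
    · exact ⟨0, .inr (Set.mem_iInter.2 hx)⟩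
    · obtain ⟨k, hk⟩ := not_forall.1 hx
      exact ⟨k, .inl hk⟩
  obtain ⟨n, hn⟩ := h.exists_not_turingCofinal_compl
    (fun n => (C n).2.1.compl.union (.iInter fun k => (C k).2.1)) hB_inv hB_mono hB_cover
  refine hn ((hdiff (C n)).mono fun x hx => ?_)
  rw [← hC] at hx
  rintro (hx' | hx')
  exacts [hx' hx.1, hx.2 (Set.mem_iInter.1 hx' _)]

/-- Every Turing invariant Borel set contains a Turing cone or is disjoint from one. -/
theorem borel_turing_determinacy (h : TuringNonapproximable)
    {A : Set (ℕ → Bool)} (hA : MeasurableSet A)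
    (hinv : TuringInvariant A) : ¬ TuringCofinal A ∨ ¬ TuringCofinal Aᶜ := by
  obtain ⟨C, hC, -, hcof, hatom⟩ := h.exists_atom
  obtain ⟨J, hJ, hJinv, hJsurj⟩ := exists_jump hC
  have key {A : Set (ℕ → Bool)} (hinv : TuringInvariant A) (hA : TuringCofinal A) :
      TuringCofinal (C ∩ J ⁻¹' A) := fun b => by
    obtain ⟨c, hc, hbc⟩ := hcof b
    obtain ⟨d, hd, hcd⟩ := hA (J c)
    obtain ⟨x, hx, hxd⟩ := hJsurj c hc d hcd
    exact ⟨_, ⟨hx, hinv _ _ hxd.symm hd⟩, hbc.trans (left_turingLE_join c x)⟩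
  exact (hatom (J ⁻¹' A) (hJ hA) fun x y hxy => hinv _ _ (hJinv x y hxy)).imp
    (mt (key hinv)) (mt (key hinv.compl))

end TuringNonapproximable

theorem measurableSet_branches (T : Set (List Bool)) : MeasurableSet (branches T) := by
  have hseg (k : ℕ) (S : Set (List Bool)) : MeasurableSet {x | initSeg x k ∈ S} := by
    induction k generalizing S with
    | zero => exact .const ([] ∈ S)
    | succ k ih =>
      have : {x | initSeg x (k + 1) ∈ S} =
          ⋃ b : Bool, {x | x k = b} ∩ {x | initSeg x k ∈ {σ | σ ++ [b] ∈ S}} := by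
        ext x
        simp [initSeg, List.range_succ]
      rw [this]
      exact .iUnion fun b => (measurableSet_apply_eq k b).inter (ih _)
  have : branches T = ⋂ k, {x | initSeg x k ∈ T} := by
    ext x
    simp [branches]
  rw [this]
  exact .iInter fun k => hseg k T

theorem PointedPerfect.measurableSet {P : Set (ℕ → Bool)} (hP : PointedPerfect P) :
    MeasurableSet P := by
  obtain ⟨T, -, rfl, -⟩ := hP
  exact measurableSet_branches T

/-- The Turing saturation of a Borel set is Borel. -/
theorem measurableSet_turingSaturation {A : Set (ℕ → Bool)} (hA : MeasurableSet A) :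
    MeasurableSet {d | ∃ y ∈ A, TuringEquiv y d} := by
  obtain ⟨φ, hφ, hφ_iff⟩ := exists_measurable_turing_enumeration
  have : {d | ∃ y ∈ A, TuringEquiv y d} = ⋃ e, {d | φ e d ∈ A ∧ TuringEquiv (φ e d) d} := by
    ext d
    rw [Set.mem_iUnion]
    constructor
    · rintro ⟨y, hy, hyd⟩
      obtain ⟨e, rfl⟩ := (hφ_iff _ _).1 hyd.1
      exact ⟨e, hy, hyd⟩
    · rintro ⟨e, hy, hyd⟩
      exact ⟨_, hy, hyd⟩
  rw [this]
  exact .iUnion fun e => (hφ e hA).inter (((hφ e).prodMk measurable_id) measurableSet_turingEquiv)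

/-- Assume that whenever Turing equivalence is written as an increasing union
`≡_T = ⋃_n E_n` of Borel equivalence relations, there are a pointed perfect set `P`
and some `i` with `E_i ↾ P = (≡_T) ↾ P`. Then every Borel homomorphism `f` from
`≡_T` to `E_0` has the `E_0`-class of `f(x)` constant on a Turing cone. -/
theorem E0_ergodicity_of_nonapproximability
    (hconj : ∀ En : ℕ → (ℕ → Bool) → (ℕ → Bool) → Prop,
      (∀ n, Equivalence (En n)) →
      (∀ n, MeasurableSet {p : (ℕ → Bool) × (ℕ → Bool) | En n p.1 p.2}) →
      (∀ n a b, En n a b → En (n + 1) a b) →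
      (∀ a b, TuringEquiv a b ↔ ∃ n, En n a b) →
      ∃ P : Set (ℕ → Bool), PointedPerfect P ∧
        ∃ i, ∀ a ∈ P, ∀ b ∈ P, (En i a b ↔ TuringEquiv a b)) :
    ∀ f : (ℕ → Bool) → ℕ → Bool, Measurable f →
      (∀ x y, TuringEquiv x y → E0 (f x) (f y)) →
      ∃ b w : ℕ → Bool, ∀ x, TuringLE b x → E0 (f x) w := by
  have h : TuringNonapproximable := hconj
  intro f hf hfE
  have hfn n : Measurable fun x => f x n := (measurable_pi_apply n).comp hf
  have hf_eq n : MeasurableSet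
      {p : (ℕ → Bool) × (ℕ → Bool) | ∀ m ≥ n, f p.1 m = f p.2 m} := by
    simp only [Set.ofPred_forall]
    exact .iInter fun m => .iInter fun _ => measurableSet_eq_fun
      ((hfn m).comp measurable_fst) ((hfn m).comp measurable_snd)
  obtain ⟨P, hP, i, hi⟩ := h (fun n x y => TuringEquiv x y ∧ ∀ m ≥ n, f x m = f y m)
    (fun n => ⟨fun x => ⟨.refl x, fun _ _ => rfl⟩, fun hxy => ⟨hxy.1.symm, fun m hm =>
      (hxy.2 m hm).symm⟩, fun hxy hyz => ⟨hxy.1.trans hyz.1, fun m hm =>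
      (hxy.2 m hm).trans (hyz.2 m hm)⟩⟩)
    (fun n => measurableSet_turingEquiv.inter (hf_eq n))
    (fun n x y hxy => ⟨hxy.1, fun m hm => hxy.2 m (Nat.le_of_succ_le hm)⟩)
    (fun x y => ⟨fun hxy => (hfE x y hxy).imp fun _ hn => ⟨hxy, hn⟩, fun ⟨_, hxy⟩ => hxy.1⟩)
  let A (n : ℕ) : Set (ℕ → Bool) := {d | ∃ y ∈ P ∩ {y | f y n = true}, TuringEquiv y d}
  have hA n : MeasurableSet (A n) := measurableSet_turingSaturation
    (hP.measurableSet.inter (measurableSet_eq_fun (hfn n) measurable_const))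
  have hAinv n : TuringInvariant (A n) :=
    fun _ _ hxy ⟨y, hy, hyx⟩ => ⟨y, hy, hyx.trans hxy⟩
  have hAf {n y} (hn : n ≥ i) (hy : y ∈ P) : y ∈ A n ↔ f y n = true := by
    refine ⟨fun ⟨z, hz, hzy⟩ => ?_, fun hfy => ⟨y, ⟨hy, hfy⟩, .refl y⟩⟩
    rw [← ((hi z hz.1 y hy).2 hzy).2 n hn]
    exact hz.2
  have hcone n : ∃ b, ∃ v : Bool, ∀ d, TuringLE b d → (d ∈ A n ↔ v = true) := by
    have := h.borel_turing_determinacy (hA n) (hAinv n)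
    simp only [TuringCofinal] at this
    push Not at this
    rcases this with ⟨b, hb⟩ | ⟨b, hb⟩
    · exact ⟨b, false, fun d hd => by simpa using fun hdA => hb d hdA hd⟩
    · exact ⟨b, true, fun d hd => by simpa using by_contra fun hdA => hb d hdA hd⟩
  choose b w hbw using hcone
  obtain ⟨b', hb'⟩ := hP.exists_cone
  refine ⟨join (joinSeq b) b', w, fun x hx => ?_⟩
  obtain ⟨y, hy, -, -, -, hyx, -⟩ := hb' x ((right_turingLE_join _ _).trans hx)
  obtain ⟨N, hN⟩ := hfE x y hyx.symm
  refine ⟨max N i, fun n hn => ?_⟩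
  rw [hN n (le_of_max_le_left hn), Bool.eq_iff_iff, ← hAf (le_of_max_le_right hn) hy,
    (hAinv n).mem_iff hyx]
  exact hbw n x ((turingLE_joinSeq b n).trans ((left_turingLE_join _ _).trans hx))

end SlamanSteel
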